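/- Suppose M is spherically symmetric about p and nonpositively curved. Then any geodesic emanating from q meets the boundary ∂Ω_1 at most twice. Moreover, if such a geodesic meets ∂Ω_1 at two points x_1 = (r_1,θ_1) and x_2 = (r_2,θ_2) (in polar coordinates centered at p) with ∠(θ_1,u_0) < ∠(θ_2,u_0), then x_1 is visible_1 while x_2 is not visible_1. -/

import Mathlib

/-!
Formalization framework for "growth competitions" (after the paper's
Section 2), at the metric-space level.

Since Mathlib does not yet have Riemannian metrics, a complete Riemannian
manifold is represented by a proper (hence complete; Hopf-Rinow) metric
space whose distance is the induced length (intrinsic) metric, and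
spherical symmetry about `p` with warping function `G` is expressed through
global geodesic polar normal coordinates `Φ : ℝⁿ ≃ M` with `Φ 0 = p` and
`dist (Φ x) p = ‖x‖`, in which the Riemannian distance is the infimum of
lengths of Lipschitz curves measured in the warped metric
`g = dr² + G(r)² dθ²`.
-/

open Set Metric Filter MeasureTheory InnerProductGeometry NNReal ENNReal
open scoped RealInnerProductSpace Classical

noncomputable section

namespace GrowthComp

variable {M : Type*} [MetricSpace M]

/-- Length of the path `γ : ℝ → M` over the time interval `[0, T]`
(the total variation of `γ` on `[0, T]`, valued in `ℝ≥0∞`). -/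
def pathLength (γ : ℝ → M) (T : ℝ) : ℝ≥0∞ := eVariationOn γ (Set.Icc 0 T)

/-- The intrinsic metric `d_S` of `M ∖ S`: the infimum of lengths of Lipschitz
paths from `x` to `y` avoiding `S` (with `sInf ∅ = ∞`). -/
def dCompl (S : Set M) (x y : M) : ℝ≥0∞ :=
  sInf {L : ℝ≥0∞ | ∃ (T : ℝ) (γ : ℝ → M), 0 ≤ T ∧ γ 0 = x ∧ γ T = y ∧
    (∃ K : ℝ≥0, LipschitzOnWith K γ (Set.Icc 0 T)) ∧
    (∀ t ∈ Set.Icc 0 T, γ t ∉ S) ∧ L = pathLength γ T}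

/-- The distance of `M` is the induced length metric (true for every
complete Riemannian manifold). -/
def IsLengthSpace (M : Type*) [MetricSpace M] : Prop :=
  ∀ x y : M, ENNReal.ofReal (dist x y) = dCompl (∅ : Set M) x y

/-- A path `γ : [0, T] → M` *avoids* the (time-indexed) family `B`:
it starts at `q`, is `λ`-Lipschitz, and `γ s ∉ B s` for all `s ∈ [0, T]`. -/
def AvoidsB (q : M) (lam : ℝ) (B : ℝ → Set M) (T : ℝ) (γ : ℝ → M) : Prop :=
  γ 0 = q ∧ LipschitzOnWith (Real.toNNReal lam) γ (Set.Icc 0 T) ∧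
    ∀ s ∈ Set.Icc 0 T, γ s ∉ B s

/-- A path `η : [0, T] → M` *avoids* the family `A`:
it starts at `p`, is `1`-Lipschitz, and `η s ∉ A s` for all `s ∈ [0, T]`. -/
def AvoidsA (p : M) (A : ℝ → Set M) (T : ℝ) (η : ℝ → M) : Prop :=
  η 0 = p ∧ LipschitzOnWith 1 η (Set.Icc 0 T) ∧ ∀ s ∈ Set.Icc 0 T, η s ∉ A s

/-- `{A_t, B_t}_{t ≥ 0}` is a *growth competition* between `p` and `q` with
speed ratio `λ`: both families are increasing, `A 0 = {q}`, `B 0 = {p}`, and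
for `t > 0`, `A t` is the union of `γ([0,t])` over paths `γ` avoiding `B`
and `B t` is the union of `η([0,t))` over paths `η` avoiding `A`. -/
structure IsGrowthCompetition (p q : M) (lam : ℝ) (A B : ℝ → Set M) : Prop where
  monoA : ∀ ⦃t₁ t₂ : ℝ⦄, 0 ≤ t₁ → t₁ ≤ t₂ → A t₁ ⊆ A t₂
  monoB : ∀ ⦃t₁ t₂ : ℝ⦄, 0 ≤ t₁ → t₁ ≤ t₂ → B t₁ ⊆ B t₂
  A_zero : A 0 = {q}
  B_zero : B 0 = {p}
  A_eq : ∀ t : ℝ, 0 < t →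
    A t = {x | ∃ γ : ℝ → M, AvoidsB q lam B t γ ∧ x ∈ γ '' Set.Icc 0 t}
  B_eq : ∀ t : ℝ, 0 < t →
    B t = {x | ∃ η : ℝ → M, AvoidsA p A t η ∧ x ∈ η '' Set.Ico 0 t}

/-- `A_∞ = ⋃_{t ≥ 0} A_t`. -/
def Ainfty (A : ℝ → Set M) : Set M := ⋃ t ∈ Set.Ici (0 : ℝ), A t

/-- `B_∞ = ⋃_{t ≥ 0} B_t`. -/
def Binfty (B : ℝ → Set M) : Set M := ⋃ t ∈ Set.Ici (0 : ℝ), B t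

/-- The recursively defined sets `Ω_n`:
`Ω_0 = ∅`, `Ω_{n+1} = Ω_n ∪ {x ∈ M ∖ Ω_n | d_{Ω_n}(x, q) > λ d(x, p)}`. -/
def OmegaSeq (p q : M) (lam : ℝ) : ℕ → Set M
  | 0 => ∅
  | n + 1 => OmegaSeq p q lam n ∪
      {x | x ∉ OmegaSeq p q lam n ∧
        ENNReal.ofReal (lam * dist x p) < dCompl (OmegaSeq p q lam n) x q}

/-- `Ω = ⋃_{n ≥ 1} Ω_n`. -/
def Omega (p q : M) (lam : ℝ) : Set M := ⋃ n : ℕ, OmegaSeq p q lam (n + 1)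

/-- `γ` is a unit-speed minimizing geodesic from `x` to `y`, parametrized on
`[0, dist x y]`. -/
def IsMinGeodesicFromTo (γ : ℝ → M) (x y : M) : Prop :=
  γ 0 = x ∧ γ (dist x y) = y ∧
    ∀ s ∈ Set.Icc (0 : ℝ) (dist x y), ∀ t ∈ Set.Icc (0 : ℝ) (dist x y),
      dist (γ s) (γ t) = |s - t|

/-- `S` is star-shaped about `p`: every minimizing geodesic from `p` to a
point of `S` lies inside `S`. -/
def StarShapedAbout (p : M) (S : Set M) : Prop :=
  ∀ x ∈ S, ∀ γ : ℝ → M, IsMinGeodesicFromTo γ p x →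
    ∀ t ∈ Set.Icc (0 : ℝ) (dist p x), γ t ∈ S

/-- `x` is *visible* from `q` through the obstacle `S`: no minimizing
geodesic joining `q` and `x` intersects `S`.  (On a nonpositively curved
simply connected manifold minimizing geodesics are unique, so this matches
"the minimizing geodesic joining `q` and `x` does not intersect `S`".) -/
def VisibleThrough (S : Set M) (q x : M) : Prop :=
  ∀ γ : ℝ → M, IsMinGeodesicFromTo γ q x →
    ∀ t ∈ Set.Icc (0 : ℝ) (dist q x), γ t ∉ S

/-! ### Spherically symmetric manifolds, via polar normal coordinates -/

/-- Euclidean `n`-space, the model space for polar normal coordinates. -/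
abbrev Euc (n : ℕ) : Type := EuclideanSpace ℝ (Fin n)

/-- The norm of the tangent vector `v` at the point `x ∈ ℝⁿ ∖ {0}` in the
spherically symmetric (warped product) metric `g = dr² + G(r)² dθ²`:
`g_x(v,v) = ⟨v, x̂⟩² + (G(‖x‖)²/‖x‖²) (‖v‖² − ⟨v, x̂⟩²)`. -/
def warpNorm {n : ℕ} (G : ℝ → ℝ) (x v : Euc n) : ℝ :=
  if x = 0 then ‖v‖
  else Real.sqrt (⟪v, ‖x‖⁻¹ • x⟫ ^ 2 +
    (G ‖x‖ / ‖x‖) ^ 2 * (‖v‖ ^ 2 - ⟪v, ‖x‖⁻¹ • x⟫ ^ 2))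

/-- The length of a (Lipschitz, hence a.e. differentiable) curve `c` on
`[0, T]` in the warped metric `dr² + G(r)² dθ²`. -/
def warpLength {n : ℕ} (G : ℝ → ℝ) (c : ℝ → Euc n) (T : ℝ) : ℝ≥0∞ :=
  ∫⁻ t in Set.Icc (0 : ℝ) T, ENNReal.ofReal (warpNorm G (c t) (deriv c t))

/-- `G` is an admissible warping function: positive and smooth on `(0,∞)`,
with `G(r) → 0` and `G(r)/r → 1` as `r → 0⁺`. -/
def IsWarping (G : ℝ → ℝ) : Prop :=
  (∀ r : ℝ, 0 < r → 0 < G r) ∧ ContDiffOn ℝ (⊤ : ℕ∞) G (Set.Ioi 0) ∧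
    Tendsto G (nhdsWithin 0 (Set.Ioi 0)) (nhds 0) ∧
    Tendsto (fun r => G r / r) (nhdsWithin 0 (Set.Ioi 0)) (nhds 1)

/-- `Φ : ℝⁿ ≃ M` realizes `M` as spherically symmetric about `p` with
warping function `G`: `Φ` is a global geodesic polar normal coordinate
chart — `Φ 0 = p` and the radial coordinate is the distance to `p` — and
the Riemannian distance of `M` is the infimum of warped lengths of
Lipschitz curves computed in the chart. -/
def IsSphericallySymmetric {n : ℕ} (p : M) (G : ℝ → ℝ) (Φ : Euc n ≃ M) : Prop :=
  IsWarping G ∧ Φ 0 = p ∧ (∀ x : Euc n, dist (Φ x) p = ‖x‖) ∧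
    ∀ x y : Euc n, ENNReal.ofReal (dist (Φ x) (Φ y)) =
      sInf {L : ℝ≥0∞ | ∃ (T : ℝ) (c : ℝ → Euc n), 0 ≤ T ∧ c 0 = x ∧ c T = y ∧
        (∃ K : ℝ≥0, LipschitzOnWith K c (Set.Icc 0 T)) ∧ L = warpLength G c T}

/-- The angular polar coordinate `θ(x) ∈ S_pM ≅ S^{n-1}` of a point
`x ≠ p`, read off through the polar chart `Φ`. -/
def polarTheta {n : ℕ} {M : Type*} [MetricSpace M] (Φ : Euc n ≃ M) (x : M) : Euc n :=
  ‖Φ.symm x‖⁻¹ • Φ.symm x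

/-- Nonpositive sectional curvature for the spherically symmetric metric
`dr² + G(r)² dθ²`: the radial sectional curvature is `−G''/G ≤ 0`,
i.e. `G` is convex, and the tangential one is `(1 − G'²)/G² ≤ 0`,
i.e. `G' ≥ 1`. -/
def NonposCurvWarping (G : ℝ → ℝ) : Prop :=
  ConvexOn ℝ (Set.Ioi 0) G ∧ ∀ r : ℝ, 0 < r → 1 ≤ deriv G r

/-- `∫₁^∞ dr / G(r) = ∞`.  For a surface of revolution this is, by a theorem
of Milnor cited in the paper, equivalent to parabolicity, i.e. conformal
equivalence to the Euclidean plane. -/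
def ParabolicWarping (G : ℝ → ℝ) : Prop :=
  ∫⁻ r in Set.Ici (1 : ℝ), ENNReal.ofReal ((G r)⁻¹) = ⊤

/-- `∫₁^∞ dr / G(r) < ∞`.  For a surface of revolution this is, by a theorem
of Milnor cited in the paper, equivalent to hyperbolicity, i.e. conformal
equivalence to the hyperbolic plane. -/
def HyperbolicWarping (G : ℝ → ℝ) : Prop :=
  ∫⁻ r in Set.Ici (1 : ℝ), ENNReal.ofReal ((G r)⁻¹) < ⊤


open scoped Topology

/-! ### The warping function -/

section Warping

variable {G : ℝ → ℝ}

theorem IsWarping.le_mul (hG : IsWarping G) (hcv : ConvexOn ℝ (Ioi 0) G) {μ r : ℝ}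
    (hμ : 0 < μ) (hμ1 : μ ≤ 1) (hr : 0 < r) : G (μ * r) ≤ μ * G r := by
  obtain ⟨-, hsm, h0, -⟩ := hG
  have hμr : 0 < μ * r := mul_pos hμ hr
  have hcont : ContinuousAt G (μ * r) :=
    hsm.continuousOn.continuousAt (Ioi_mem_nhds hμr)
  have hlin : Tendsto (fun ε : ℝ => μ * r + (1 - μ) * ε) (𝓝[>] 0) (𝓝 (μ * r)) := by
    have : Continuous (fun ε : ℝ => μ * r + (1 - μ) * ε) := by fun_prop
    simpa using (this.tendsto 0).mono_left nhdsWithin_le_nhds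
  have hright : Tendsto (fun ε : ℝ => μ * G r + (1 - μ) * G ε) (𝓝[>] 0) (𝓝 (μ * G r)) := by
    simpa using (h0.const_mul (1 - μ)).const_add (μ * G r)
  refine le_of_tendsto_of_tendsto (hcont.tendsto.comp hlin) hright ?_
  filter_upwards [self_mem_nhdsWithin] with ε hε
  simpa using hcv.2 (mem_Ioi.2 hr) hε hμ.le (sub_nonneg.2 hμ1) (by ring)

theorem IsWarping.ratio_mono (hG : IsWarping G) (hcv : ConvexOn ℝ (Ioi 0) G) {r R : ℝ}
    (hr : 0 < r) (hrR : r ≤ R) : G r / r ≤ G R / R := by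
  have hR : 0 < R := hr.trans_le hrR
  have h := hG.le_mul hcv (div_pos hr hR) ((div_le_one hR).2 hrR) hR
  rw [div_mul_cancel₀ _ hR.ne'] at h
  rw [div_le_iff₀ hr]
  calc G r ≤ r / R * G R := h
    _ = G R / R * r := by ring

theorem IsWarping.one_le_ratio (hG : IsWarping G) (hcv : ConvexOn ℝ (Ioi 0) G) {r : ℝ}
    (hr : 0 < r) : 1 ≤ G r / r := by
  refine le_of_tendsto hG.2.2.2 ?_
  filter_upwards [Ioo_mem_nhdsGT hr] with ε hε
  exact hG.ratio_mono hcv hε.1 hε.2.le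

end Warping

/-! ### The warped norm -/

section WarpNorm

variable {n : ℕ} {G : ℝ → ℝ}

theorem warpNorm_zero_left (v : Euc n) : warpNorm G 0 v = ‖v‖ := if_pos rfl

theorem warpNorm_nonneg (x v : Euc n) : 0 ≤ warpNorm G x v := by
  unfold warpNorm
  split_ifs
  · exact norm_nonneg v
  · exact Real.sqrt_nonneg _

theorem sq_inner_normalize_le {x : Euc n} (hx : x ≠ 0) (v : Euc n) :
    ⟪v, ‖x‖⁻¹ • x⟫ ^ 2 ≤ ‖v‖ ^ 2 := by
  have h := abs_real_inner_le_norm v (‖x‖⁻¹ • x)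
  rw [norm_smul, norm_inv, norm_norm, inv_mul_cancel₀ (norm_ne_zero_iff.2 hx), mul_one] at h
  rw [← sq_abs]
  gcongr

theorem warpNorm_sq {x : Euc n} (hx : x ≠ 0) (v : Euc n) :
    warpNorm G x v ^ 2 = ⟪v, ‖x‖⁻¹ • x⟫ ^ 2 +
      (G ‖x‖ / ‖x‖) ^ 2 * (‖v‖ ^ 2 - ⟪v, ‖x‖⁻¹ • x⟫ ^ 2) := by
  have := sq_inner_normalize_le hx v
  rw [warpNorm, if_neg hx, Real.sq_sqrt]
  have : 0 ≤ ‖v‖ ^ 2 - ⟪v, ‖x‖⁻¹ • x⟫ ^ 2 := by linarith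
  positivity

theorem norm_le_warpNorm (hG : IsWarping G) (hcv : ConvexOn ℝ (Ioi 0) G) (x v : Euc n) :
    ‖v‖ ≤ warpNorm G x v := by
  by_cases hx : x = 0
  · rw [hx, warpNorm_zero_left]
  refine (sq_le_sq₀ (norm_nonneg v) (warpNorm_nonneg x v)).1 ?_
  rw [warpNorm_sq hx]
  have h1 := sq_inner_normalize_le hx v
  have h2 : 1 ≤ (G ‖x‖ / ‖x‖) ^ 2 :=
    one_le_pow₀ (hG.one_le_ratio hcv (norm_pos_iff.2 hx))
  nlinarith [mul_nonneg (sub_nonneg.2 h2) (sub_nonneg.2 h1)]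

theorem warpNorm_le (hG : IsWarping G) (hcv : ConvexOn ℝ (Ioi 0) G) {R : ℝ} (hR : 0 < R)
    {x : Euc n} (hxR : ‖x‖ ≤ R) (v : Euc n) : warpNorm G x v ≤ G R / R * ‖v‖ := by
  have hR1 := hG.one_le_ratio hcv hR
  by_cases hx : x = 0
  · rw [hx, warpNorm_zero_left]
    exact le_mul_of_one_le_left (norm_nonneg v) hR1
  have hx0 := norm_pos_iff.2 hx
  refine (sq_le_sq₀ (warpNorm_nonneg _ _) (by positivity)).1 ?_
  rw [warpNorm_sq hx, mul_pow]
  have h1 := sq_inner_normalize_le hx v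
  have h2 : 1 ≤ (G R / R) ^ 2 := one_le_pow₀ hR1
  have h3 : (G ‖x‖ / ‖x‖) ^ 2 ≤ (G R / R) ^ 2 :=
    pow_le_pow_left₀ (zero_le_one.trans (hG.one_le_ratio hcv hx0)) (hG.ratio_mono hcv hx0 hxR) 2
  nlinarith [mul_nonneg (sub_nonneg.2 h3) (sub_nonneg.2 h1),
    mul_nonneg (sub_nonneg.2 h2) (sq_nonneg ⟪v, ‖x‖⁻¹ • x⟫)]

theorem warpNorm_smul_add_smul_sq_le (hG : IsWarping G) (hcv : ConvexOn ℝ (Ioi 0) G) {μ : ℝ}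
    (hμ : 0 < μ) (hμ1 : μ ≤ 1) (σ : ℝ) (x v : Euc n) :
    warpNorm G (μ • x) (μ • v + σ • x) ^ 2 ≤
      μ ^ 2 * warpNorm G x v ^ 2 + 2 * μ * σ * ⟪x, v⟫ + σ ^ 2 * ‖x‖ ^ 2 := by
  by_cases hx : x = 0
  · subst hx
    simp [warpNorm_zero_left, norm_smul, mul_pow]
  have hx0 := norm_pos_iff.2 hx
  have hnorm : ‖μ • x‖ = μ * ‖x‖ := by rw [norm_smul, Real.norm_of_nonneg hμ.le]
  have hdir : ‖μ • x‖⁻¹ • μ • x = ‖x‖⁻¹ • x := by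
    rw [hnorm, smul_smul, mul_inv, mul_right_comm, inv_mul_cancel₀ hμ.ne', one_mul]
  rw [warpNorm_sq (smul_ne_zero hμ.ne' hx), warpNorm_sq hx, hdir, hnorm]
  set k := G ‖x‖ / ‖x‖ with hk
  have hk' : (G (μ * ‖x‖) / (μ * ‖x‖)) ^ 2 ≤ k ^ 2 := by
    have hμx : 0 < μ * ‖x‖ := by positivity
    exact pow_le_pow_left₀ (zero_le_one.trans (hG.one_le_ratio hcv hμx))
      (hG.ratio_mono hcv hμx (mul_le_of_le_one_left hx0.le hμ1)) 2
  set a := ⟪v, ‖x‖⁻¹ • x⟫ with ha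
  have hxv : ⟪x, v⟫ = ‖x‖ * a := by
    rw [ha, inner_smul_right, real_inner_comm v x]
    field_simp
  have hin : ⟪μ • v + σ • x, ‖x‖⁻¹ • x⟫ = μ * a + σ * ‖x‖ := by
    rw [inner_add_left, inner_smul_left, inner_smul_left, inner_smul_right x x,
      real_inner_self_eq_norm_sq]
    simp only [conj_trivial, ← ha]
    field_simp
  have hns : ‖μ • v + σ • x‖ ^ 2 = μ ^ 2 * ‖v‖ ^ 2 + 2 * μ * σ * (‖x‖ * a) + σ ^ 2 * ‖x‖ ^ 2 := by
    rw [norm_add_sq_real, inner_smul_left, inner_smul_right, norm_smul, norm_smul, mul_pow,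
      mul_pow, real_inner_comm x v, hxv]
    simp only [conj_trivial, Real.norm_eq_abs, sq_abs]
    ring
  rw [hin, hns, hxv]
  have h1 : a ^ 2 ≤ ‖v‖ ^ 2 := sq_inner_normalize_le hx v
  nlinarith [mul_nonneg (sub_nonneg.2 hk') (mul_nonneg (sq_nonneg μ) (sub_nonneg.2 h1))]

theorem warpNorm_isometry (e : Euc n ≃ₗᵢ[ℝ] Euc n) (x v : Euc n) :
    warpNorm G (e x) (e v) = warpNorm G x v := by
  simp [warpNorm, inner_smul_right]

theorem warpNorm_smul_smul_le {ρ : ℝ} (hρ : 0 < ρ) (σ : ℝ) (x : Euc n) :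
    warpNorm G (ρ • x) (σ • x) ≤ |σ| * ‖x‖ := by
  by_cases hx : x = 0
  · simp [hx, warpNorm_zero_left]
  have hx0 := norm_pos_iff.2 hx
  refine (sq_le_sq₀ (warpNorm_nonneg _ _) (by positivity)).1 ?_
  have hnorm : ‖ρ • x‖ = ρ * ‖x‖ := by rw [norm_smul, Real.norm_of_nonneg hρ.le]
  have hin : ⟪σ • x, ‖ρ • x‖⁻¹ • ρ • x⟫ = σ * ‖x‖ := by
    rw [hnorm, inner_smul_left, inner_smul_right, inner_smul_right, real_inner_self_eq_norm_sq]
    simp only [conj_trivial]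
    field_simp
  rw [warpNorm_sq (smul_ne_zero hρ.ne' hx), hin, norm_smul σ x, Real.norm_eq_abs]
  simp [mul_pow]

theorem measurable_warpNorm_comp (hG : IsWarping G) {α : Type*} [MeasurableSpace α]
    {c v : α → Euc n} (hc : Measurable c) (hv : Measurable v) :
    Measurable fun t => warpNorm G (c t) (v t) := by
  have hG' : Measurable ((Ioi (0 : ℝ)).piecewise G 0) :=
    hG.2.1.continuousOn.measurable_piecewise continuousOn_const measurableSet_Ioi
  have heq : (fun t => warpNorm G (c t) (v t)) =
      fun t => warpNorm ((Ioi (0 : ℝ)).piecewise G 0) (c t) (v t) := by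
    funext t
    by_cases h : c t = 0
    · simp [h, warpNorm_zero_left]
    · simp [warpNorm, h]
  rw [heq]
  unfold warpNorm
  refine Measurable.ite (measurableSet_eq_fun hc measurable_const) hv.norm ?_
  fun_prop

end WarpNorm

/-! ### Curves and their arc length in the chart -/

section Curves

variable {n : ℕ} {G : ℝ → ℝ}

theorem AbsolutelyContinuousOnInterval.le_of_ae_deriv_nonneg {ψ : ℝ → ℝ} {s t : ℝ} (hst : s ≤ t)
    (hψ : AbsolutelyContinuousOnInterval ψ s t) (h : ∀ᵐ u, u ∈ Icc s t → 0 ≤ deriv ψ u) :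
    ψ s ≤ ψ t := by
  rw [← sub_nonneg, ← hψ.integral_deriv_eq_sub]
  refine intervalIntegral.integral_nonneg_of_ae_restrict hst ?_
  exact (ae_restrict_iff' measurableSet_Icc).2 h

theorem IsSphericallySymmetric.dist_le {p : M} {Φ : Euc n ≃ M}
    (hsym : IsSphericallySymmetric p G Φ) {T : ℝ} (hT : 0 ≤ T) {c : ℝ → Euc n} {K : ℝ≥0}
    (hc : LipschitzOnWith K c (Icc 0 T)) {E : ℝ → ℝ} (hE : AbsolutelyContinuousOnInterval E 0 T)
    (h : ∀ᵐ t, t ∈ Icc 0 T → warpNorm G (c t) (deriv c t) ≤ deriv E t) :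
    dist (Φ (c 0)) (Φ (c T)) ≤ E T - E 0 := by
  have hnn : ∀ᵐ t, t ∈ Icc 0 T → 0 ≤ deriv E t := by
    filter_upwards [h] with t ht hmem using (warpNorm_nonneg _ _).trans (ht hmem)
  have hlen : ENNReal.ofReal (dist (Φ (c 0)) (Φ (c T))) ≤ warpLength G c T := by
    rw [hsym.2.2.2]
    exact sInf_le ⟨T, c, hT, rfl, rfl, ⟨K, hc⟩, rfl⟩
  have hEint : IntegrableOn (deriv E) (Icc 0 T) :=
    (intervalIntegrable_iff_integrableOn_Icc_of_le hT).1 hE.intervalIntegrable_deriv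
  have hle : warpLength G c T ≤ ENNReal.ofReal (E T - E 0) := by
    rw [← hE.integral_deriv_eq_sub, intervalIntegral.integral_of_le hT,
      ← integral_Icc_eq_integral_Ioc,
      ofReal_integral_eq_lintegral_ofReal hEint ((ae_restrict_iff' measurableSet_Icc).2 hnn)]
    refine lintegral_mono_ae ((ae_restrict_iff' measurableSet_Icc).2 ?_)
    filter_upwards [h] with t ht hmem using ENNReal.ofReal_le_ofReal (ht hmem)
  have hE0 : E 0 ≤ E T := AbsolutelyContinuousOnInterval.le_of_ae_deriv_nonneg hT hE hnn
  exact (ENNReal.ofReal_le_ofReal_iff (sub_nonneg.2 hE0)).1 (hlen.trans hle)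

/-- `c` is a Lipschitz curve and `W` is an arc length function for it in the warped metric. -/
structure IsArcLength (G : ℝ → ℝ) (c : ℝ → Euc n) (W : ℝ → ℝ) : Prop where
  lipschitz_curve : ∃ K : ℝ≥0, LipschitzWith K c
  lipschitz_length : ∃ K : ℝ≥0, LipschitzWith K W
  ae_hasDerivAt : ∀ᵐ t, HasDerivAt c (deriv c t) t ∧
    HasDerivAt W (warpNorm G (c t) (deriv c t)) t

theorem IsSphericallySymmetric.exists_isArcLength {p : M} {Φ : Euc n ≃ M}
    (hsym : IsSphericallySymmetric p G Φ) (hcv : ConvexOn ℝ (Ioi 0) G) {x y : Euc n} {ℓ : ℝ}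
    (h : dist (Φ x) (Φ y) < ℓ) :
    ∃ (T : ℝ) (c : ℝ → Euc n) (W : ℝ → ℝ), 0 ≤ T ∧ IsArcLength G c W ∧
      c 0 = x ∧ c T = y ∧ W 0 = 0 ∧ W T < ℓ := by
  have hlt : ENNReal.ofReal (dist (Φ x) (Φ y)) < ENNReal.ofReal ℓ :=
    (ENNReal.ofReal_lt_ofReal_iff (dist_nonneg.trans_lt h)).2 h
  rw [hsym.2.2.2] at hlt
  obtain ⟨L, ⟨T, c₀, hT, hx, hy, ⟨K, hK⟩, rfl⟩, hL⟩ := sInf_lt_iff.1 hlt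
  set c : ℝ → Euc n := fun t => c₀ (projIcc 0 T hT t) with hc
  have hcK : LipschitzWith K c := by
    have := hK.to_restrict.comp (LipschitzWith.projIcc hT)
    rwa [mul_one] at this
  have hc_eq : ∀ t ∈ Icc 0 T, c t = c₀ t := fun t ht => by
    simp [hc, projIcc_of_mem hT ht]
  have hc0 : c 0 = x := by rw [hc_eq 0 ⟨le_rfl, hT⟩, hx]
  have hcT : c T = y := by rw [hc_eq T ⟨hT, le_rfl⟩, hy]
  set w : ℝ → ℝ := fun t => warpNorm G (c t) (deriv c t) with hw
  have hwmeas : Measurable w :=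
    measurable_warpNorm_comp hsym.1 hcK.continuous.measurable (measurable_deriv c)
  set R : ℝ := ‖x‖ + K * T + 1 with hR
  have hRpos : 0 < R := by positivity
  have hcR : ∀ t, ‖c t‖ ≤ R := by
    intro t
    have hp := (projIcc 0 T hT t).2
    have h1 : ‖c t - x‖ ≤ K * T := by
      rw [← hx, ← dist_eq_norm]
      refine (hK.dist_le_mul _ hp 0 ⟨le_rfl, hT⟩).trans ?_
      gcongr
      rw [Real.dist_eq, sub_zero, abs_of_nonneg hp.1]
      exact hp.2
    linarith [norm_le_norm_add_norm_sub' (c t) x]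
  have hratio : 0 ≤ G R / R := zero_le_one.trans (hsym.1.one_le_ratio hcv hRpos)
  set C : ℝ≥0 := (G R / R).toNNReal * K with hC
  have hwC : ∀ t, ‖w t‖ ≤ C := by
    intro t
    rw [Real.norm_of_nonneg (warpNorm_nonneg _ _)]
    refine (warpNorm_le hsym.1 hcv hRpos (hcR t) _).trans ?_
    rw [hC, NNReal.coe_mul, Real.coe_toNNReal _ hratio]
    exact mul_le_mul_of_nonneg_left (norm_deriv_le_of_lipschitz hcK) hratio
  have hwint : LocallyIntegrable w volume :=
    (locallyIntegrable_const (C : ℝ)).mono hwmeas.aestronglyMeasurable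
      (Eventually.of_forall fun t => (hwC t).trans (le_abs_self _))
  have hwii : ∀ a b : ℝ, IntervalIntegrable w volume a b := fun a b =>
    intervalIntegrable_iff.2
      ((hwint.integrableOn_isCompact isCompact_uIcc).mono_set uIoc_subset_uIcc)
  have hlen : warpLength G c₀ T = ∫⁻ t in Icc 0 T, ENNReal.ofReal (w t) := by
    unfold warpLength
    rw [restrict_Ioo_eq_restrict_Icc.symm]
    refine setLIntegral_congr_fun measurableSet_Ioo fun t ht => ?_
    have hev : c =ᶠ[𝓝 t] c₀ := by
      filter_upwards [Icc_mem_nhds ht.1 ht.2] with u hu using hc_eq u hu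
    simp only [hw, hev.deriv_eq, hev.eq_of_nhds]
  refine ⟨T, c, fun t => ∫ u in (0 : ℝ)..t, w u, hT, ⟨⟨K, hcK⟩, ⟨C, ?_⟩, ?_⟩, hc0, hcT, by simp, ?_⟩
  · refine LipschitzWith.of_dist_le_mul fun a b => ?_
    rw [Real.dist_eq, Real.dist_eq,
      intervalIntegral.integral_interval_sub_left (hwii 0 a) (hwii 0 b)]
    exact intervalIntegral.norm_integral_le_of_norm_le_const fun t _ => hwC t
  · filter_upwards [hcK.ae_differentiableAt_real,
      LocallyIntegrable.ae_hasDerivAt_integral hwint] with t h1 h2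
    exact ⟨h1.hasDerivAt, h2 0⟩
  · rw [hlen, ← ofReal_integral_eq_lintegral_ofReal (hwint.integrableOn_isCompact isCompact_Icc)
      (Eventually.of_forall fun t => warpNorm_nonneg _ _), integral_Icc_eq_integral_Ioc,
      ← intervalIntegral.integral_of_le hT] at hL
    exact (ENNReal.ofReal_lt_ofReal_iff'.1 hL).1

namespace IsArcLength

variable {c : ℝ → Euc n} {W : ℝ → ℝ}

theorem monotone (h : IsArcLength G c W) : Monotone W := by
  intro s t hst
  obtain ⟨K, hK⟩ := h.lipschitz_length
  refine AbsolutelyContinuousOnInterval.le_of_ae_deriv_nonneg hst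
    (hK.lipschitzOnWith.absolutelyContinuousOnInterval) ?_
  filter_upwards [h.ae_hasDerivAt] with u hu _
  rw [hu.2.deriv]
  exact warpNorm_nonneg _ _

theorem norm_sub_le (h : IsArcLength G c W) (hG : IsWarping G) (hcv : ConvexOn ℝ (Ioi 0) G)
    {s t : ℝ} (hst : s ≤ t) : ‖c t - c s‖ ≤ W t - W s := by
  obtain ⟨K, hK⟩ := h.lipschitz_curve
  obtain ⟨C, hC⟩ := h.lipschitz_length
  set e := c t - c s with he
  rcases (norm_nonneg e).eq_or_lt with h0 | h0
  · rw [← h0]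
    exact sub_nonneg.2 (h.monotone hst)
  have hAC1 : AbsolutelyContinuousOnInterval (fun u => ‖e‖ * W u) s t :=
    (hC.lipschitzOnWith.absolutelyContinuousOnInterval).const_mul ‖e‖
  have hAC2 : AbsolutelyContinuousOnInterval (fun u => (innerSL ℝ e) (c u)) s t :=
    ((innerSL ℝ e).lipschitz.comp hK).lipschitzOnWith.absolutelyContinuousOnInterval
  have key := AbsolutelyContinuousOnInterval.le_of_ae_deriv_nonneg hst (hAC1.sub hAC2) (by
    filter_upwards [h.ae_hasDerivAt] with u hu _
    have hd := (hu.2.const_mul ‖e‖).sub ((innerSL ℝ e).hasFDerivAt.comp_hasDerivAt u hu.1)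
    have hd' : deriv ((fun u => ‖e‖ * W u) - fun u => (innerSL ℝ e) (c u)) u = _ := hd.deriv
    rw [hd', innerSL_apply_apply]
    have h1 := real_inner_le_norm e (deriv c u)
    have h2 := norm_le_warpNorm hG hcv (c u) (deriv c u)
    nlinarith)
  simp only [Pi.sub_apply, innerSL_apply_apply] at key
  have hee : ⟪e, c t⟫ - ⟪e, c s⟫ = ‖e‖ ^ 2 := by
    rw [← inner_sub_right, ← he, real_inner_self_eq_norm_sq]
  nlinarith

theorem dist_le (h : IsArcLength G c W) {p : M} {Φ : Euc n ≃ M}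
    (hsym : IsSphericallySymmetric p G Φ) {s t : ℝ} (hst : s ≤ t) :
    dist (Φ (c s)) (Φ (c t)) ≤ W t - W s := by
  obtain ⟨K, hK⟩ := h.lipschitz_curve
  obtain ⟨C, hC⟩ := h.lipschitz_length
  have hshift : LipschitzWith 1 (fun u : ℝ => u + s) :=
    LipschitzWith.of_dist_le_mul fun a b => by simp
  have hae : ∀ᵐ u, HasDerivAt c (deriv c (u + s)) (u + s) ∧
      HasDerivAt W (warpNorm G (c (u + s)) (deriv c (u + s))) (u + s) :=
    (measurePreserving_add_right volume s).quasiMeasurePreserving.ae h.ae_hasDerivAt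
  have := hsym.dist_le (sub_nonneg.2 hst) (c := fun u => c (u + s)) (E := fun u => W (u + s))
    (hK.comp hshift).lipschitzOnWith
    (hC.comp hshift).lipschitzOnWith.absolutelyContinuousOnInterval (by
      filter_upwards [hae] with u hu _
      rw [deriv_comp_add_const, deriv_comp_add_const, hu.2.deriv])
  simpa using this

end IsArcLength

theorem IsSphericallySymmetric.norm_sub_le_dist {p : M} {Φ : Euc n ≃ M}
    (hsym : IsSphericallySymmetric p G Φ) (hcv : ConvexOn ℝ (Ioi 0) G) (x y : Euc n) :
    ‖x - y‖ ≤ dist (Φ x) (Φ y) := by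
  refine le_of_forall_gt_imp_ge_of_dense fun ℓ hℓ => ?_
  obtain ⟨T, c, W, hT, hW, rfl, rfl, hW0, hWT⟩ := hsym.exists_isArcLength hcv hℓ
  have := hW.norm_sub_le hsym.1 hcv hT
  rw [norm_sub_rev] at this
  linarith

theorem IsSphericallySymmetric.dCompl_empty {p : M} {Φ : Euc n ≃ M}
    (hsym : IsSphericallySymmetric p G Φ) (hcv : ConvexOn ℝ (Ioi 0) G) (a b : M) :
    dCompl (∅ : Set M) a b = ENNReal.ofReal (dist a b) := by
  apply le_antisymm
  · refine le_of_forall_gt_imp_ge_of_dense fun L hL => ?_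
    obtain ⟨ℓ, hℓ0, hℓ, hℓL⟩ := ENNReal.lt_iff_exists_real_btwn.1 hL
    refine le_trans ?_ hℓL.le
    have hd : dist (Φ (Φ.symm a)) (Φ (Φ.symm b)) < ℓ := by
      simpa using (ENNReal.ofReal_lt_ofReal_iff'.1 hℓ).1
    obtain ⟨T, c, W, hT, hW, hc0, hcT, hW0, hWT⟩ := hsym.exists_isArcLength hcv hd
    obtain ⟨C, hC⟩ := hW.lipschitz_length
    have hdist : ∀ s t, dist (Φ (c s)) (Φ (c t)) ≤ dist (W s) (W t) := by
      intro s t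
      rcases le_total s t with hst | hst
      · rw [dist_comm (W s), Real.dist_eq]
        exact (hW.dist_le hsym hst).trans (le_abs_self _)
      · rw [dist_comm (Φ (c s)), Real.dist_eq]
        exact (hW.dist_le hsym hst).trans (le_abs_self _)
    have hlip : LipschitzWith C fun t => Φ (c t) :=
      LipschitzWith.of_dist_le_mul fun s t => (hdist s t).trans (hC.dist_le_mul s t)
    calc dCompl ∅ a b ≤ pathLength (fun t => Φ (c t)) T :=
          sInf_le ⟨T, fun t => Φ (c t), hT, by simp [hc0], by simp [hcT],
            ⟨C, hlip.lipschitzOnWith⟩, by simp, rfl⟩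
      _ ≤ eVariationOn W (Icc 0 T) := by
          refine iSup_le fun P => ?_
          refine le_trans (Finset.sum_le_sum fun i _ => ?_)
            (eVariationOn.sum_le P.2.2.1 P.2.2.2)
          rw [edist_dist, edist_dist]
          exact ENNReal.ofReal_le_ofReal (hdist _ _)
      _ ≤ ENNReal.ofReal (W T - W 0) := by
          have := (hW.monotone.monotoneOn (Icc 0 T)).eVariationOn_eq
            (left_mem_Icc.2 hT) (right_mem_Icc.2 hT)
          rw [inter_self] at this
          exact this.le
      _ ≤ ENNReal.ofReal ℓ := ENNReal.ofReal_le_ofReal (by linarith)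
  · refine le_sInf ?_
    rintro L ⟨T, γ, hT, rfl, rfl, -, -, rfl⟩
    rw [← edist_dist]
    exact eVariationOn.edist_le γ (left_mem_Icc.2 hT) (right_mem_Icc.2 hT)

end Curves

/-! ### Strong convexity of the squared distance to the center along geodesics -/

section Convexity

variable {n : ℕ} {G : ℝ → ℝ} {p : M} {Φ : Euc n ≃ M}

theorem IsSphericallySymmetric.dist_smul_mul_le_of_isArcLength
    (hsym : IsSphericallySymmetric p G Φ) (hcv : ConvexOn ℝ (Ioi 0) G) {c : ℝ → Euc n}
    {W : ℝ → ℝ} (hW : IsArcLength G c W) {T : ℝ} (hT : 0 ≤ T) (hW0 : W 0 = 0) (hL : 0 < W T)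
    {R : ℝ} (hR : ‖c 0‖ + W T ≤ R) {s : ℝ} (hs : 0 < s) (hs2 : s ≤ 1 / 2) :
    dist (Φ (c 0)) (Φ ((1 - s) • c T)) * W T ≤
      W T ^ 2 * (1 - s / 2) - s / 2 * (‖c T‖ ^ 2 - ‖c 0‖ ^ 2) + s ^ 2 * R ^ 2 := by
  obtain ⟨K, hK⟩ := hW.lipschitz_curve
  obtain ⟨C, hC⟩ := hW.lipschitz_length
  set L := W T with hLdef
  set σ := s / L with hσ
  have hσ0 : 0 < σ := div_pos hs hL
  have hσL : σ * L = s := div_mul_cancel₀ s hL.ne'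
  have hWnn : ∀ t ∈ Icc 0 T, 0 ≤ W t := fun t ht => hW0 ▸ hW.monotone ht.1
  have hWle : ∀ t ∈ Icc 0 T, W t ≤ L := fun t ht => hW.monotone ht.2
  have hcR : ∀ t ∈ Icc 0 T, ‖c t‖ ≤ R := fun t ht => by
    have := hW.norm_sub_le hsym.1 hcv ht.1
    linarith [norm_le_norm_add_norm_sub' (c t) (c 0), hWle t ht]
  have hR0 : 0 ≤ R := (norm_nonneg _).trans (hcR 0 ⟨le_rfl, hT⟩)
  have hμ1 : ∀ t ∈ Icc 0 T, 1 - σ * W t ≤ 1 := fun t ht => by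
    linarith [mul_nonneg hσ0.le (hWnn t ht)]
  have hμ2 : ∀ t ∈ Icc 0 T, 1 / 2 ≤ 1 - σ * W t := fun t ht => by
    linarith [mul_le_mul_of_nonneg_left (hWle t ht) hσ0.le]
  have hlip : LipschitzOnWith (K + (σ * C * R).toNNReal) (fun t => (1 - σ * W t) • c t)
      (Icc 0 T) := by
    refine LipschitzOnWith.of_dist_le_mul fun a ha b hb => ?_
    have hdecomp : (1 - σ * W a) • c a - (1 - σ * W b) • c b =
        (1 - σ * W a) • (c a - c b) + (σ * (W b - W a)) • c b := by module
    have h1 : ‖c a - c b‖ ≤ K * dist a b := by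
      simpa [dist_eq_norm] using hK.dist_le_mul a b
    have h2 : |W b - W a| ≤ C * dist a b := by
      simpa [Real.dist_eq, abs_sub_comm] using hC.dist_le_mul a b
    have h3 : |1 - σ * W a| ≤ 1 := by
      rw [abs_of_nonneg (by linarith [hμ2 a ha])]
      exact hμ1 a ha
    rw [dist_eq_norm, hdecomp, NNReal.coe_add, Real.coe_toNNReal _ (by positivity), add_mul]
    refine (norm_add_le _ _).trans (add_le_add ?_ ?_)
    · rw [norm_smul, Real.norm_eq_abs]
      exact (mul_le_of_le_one_left (norm_nonneg _) h3).trans h1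
    · rw [norm_smul, Real.norm_eq_abs, abs_mul, abs_of_pos hσ0]
      calc σ * |W b - W a| * ‖c b‖ ≤ σ * (C * dist a b) * R := by
            gcongr
            exact hcR b hb
        _ = σ * C * R * dist a b := by ring
  have hWAC : AbsolutelyContinuousOnInterval W 0 T :=
    hC.lipschitzOnWith.absolutelyContinuousOnInterval
  have hcAC : AbsolutelyContinuousOnInterval (fun t => ‖c t‖) 0 T :=
    (lipschitzWith_one_norm.comp hK).lipschitzOnWith.absolutelyContinuousOnInterval
  set E : ℝ → ℝ := fun t => (1 + σ ^ 2 * R ^ 2) * W t - σ / 2 * (W t * W t) -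
    σ / 2 * (‖c t‖ * ‖c t‖) with hE
  have hEAC : AbsolutelyContinuousOnInterval E 0 T :=
    ((hWAC.const_mul _).sub ((hWAC.mul hWAC).const_mul _)).sub ((hcAC.mul hcAC).const_mul _)
  have key := hsym.dist_le hT hlip hEAC (by
    filter_upwards [hW.ae_hasDerivAt] with t ht hmem
    obtain ⟨hc', hW'⟩ := ht
    set w := warpNorm G (c t) (deriv c t) with hw
    have hw0 : 0 ≤ w := warpNorm_nonneg _ _
    have hEd : HasDerivAt E ((1 + σ ^ 2 * R ^ 2) * w - σ / 2 * (w * W t + W t * w) -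
        σ / 2 * (2 * ⟪c t, deriv c t⟫)) t := by
      refine ((hW'.const_mul _).sub ((hW'.mul hW').const_mul _)).sub (HasDerivAt.const_mul _ ?_)
      simpa only [pow_two] using hc'.norm_sq
    have hcd : HasDerivAt (fun t => (1 - σ * W t) • c t)
        ((1 - σ * W t) • deriv c t + (-(σ * w)) • c t) t :=
      ((hW'.const_mul σ).const_sub 1).smul hc'
    rw [hEd.deriv, hcd.deriv]
    set μ := 1 - σ * W t with hμ
    have hμ2t : 1 / 2 ≤ μ := hμ2 t hmem
    have hsq := warpNorm_smul_add_smul_sq_le hsym.1 hcv (by linarith) (hμ1 t hmem)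
      (-(σ * w)) (c t) (deriv c t)
    rw [← hw, ← hμ] at hsq
    set ρ := ⟪c t, deriv c t⟫ with hρ
    have hρle : ρ ≤ R * w := (real_inner_le_norm _ _).trans
      (mul_le_mul (hcR t hmem) (norm_le_warpNorm hsym.1 hcv _ _) (norm_nonneg _) hR0)
    have hEq : (1 + σ ^ 2 * R ^ 2) * w - σ / 2 * (w * W t + W t * w) - σ / 2 * (2 * ρ) =
        μ * w - σ * ρ + σ ^ 2 * R ^ 2 * w := by
      rw [hμ]
      ring
    rw [hEq]
    have hnn : 0 ≤ μ * w - σ * ρ + σ ^ 2 * R ^ 2 * w := by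
      have h1 : σ * ρ ≤ σ * (R * w) := mul_le_mul_of_nonneg_left hρle hσ0.le
      have h2 : 1 / 2 * w ≤ μ * w := mul_le_mul_of_nonneg_right hμ2t hw0
      nlinarith [mul_nonneg (sq_nonneg (σ * R - 1 / 2)) hw0]
    refine (sq_le_sq₀ (warpNorm_nonneg _ _) hnn).1 (hsq.trans ?_)
    have h1 : ‖c t‖ ^ 2 ≤ R ^ 2 := pow_le_pow_left₀ (norm_nonneg _) (hcR t hmem) 2
    have h2 : σ ^ 2 * w ^ 2 * ‖c t‖ ^ 2 ≤ σ ^ 2 * w ^ 2 * R ^ 2 :=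
      mul_le_mul_of_nonneg_left h1 (by positivity)
    have h3 : 1 / 2 * (σ ^ 2 * w ^ 2 * R ^ 2) ≤ μ * (σ ^ 2 * w ^ 2 * R ^ 2) :=
      mul_le_mul_of_nonneg_right hμ2t (by positivity)
    nlinarith [sq_nonneg (σ * (ρ - σ * R ^ 2 * w))])
  simp only [hE, hW0, mul_zero, sub_zero, one_smul, zero_sub, ← hLdef, hσL] at key
  calc _ ≤ _ := mul_le_mul_of_nonneg_right key hL.le
    _ = L ^ 2 + (σ * L) ^ 2 * R ^ 2 - σ * L / 2 * L ^ 2 -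
        σ * L / 2 * (‖c T‖ ^ 2 - ‖c 0‖ ^ 2) := by ring
    _ = _ := by
      rw [hσL]
      ring

theorem IsSphericallySymmetric.dist_smul_mul_le (hsym : IsSphericallySymmetric p G Φ)
    (hcv : ConvexOn ℝ (Ioi 0) G) {x y : Euc n} (hxy : x ≠ y) {s : ℝ} (hs : 0 < s)
    (hs2 : s ≤ 1 / 2) :
    dist (Φ x) (Φ ((1 - s) • y)) * dist (Φ x) (Φ y) ≤
      dist (Φ x) (Φ y) ^ 2 * (1 - s / 2) - s / 2 * (‖y‖ ^ 2 - ‖x‖ ^ 2) +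
        s ^ 2 * (‖x‖ + dist (Φ x) (Φ y) + 1) ^ 2 := by
  set d := dist (Φ x) (Φ y) with hd
  have hd0 : 0 < d := dist_pos.2 (Φ.injective.ne hxy)
  set A : Set ℝ := {L | dist (Φ x) (Φ ((1 - s) • y)) * L ≤
      L ^ 2 * (1 - s / 2) - s / 2 * (‖y‖ ^ 2 - ‖x‖ ^ 2) + s ^ 2 * (‖x‖ + d + 1) ^ 2} with hA
  have hclosed : IsClosed A := isClosed_le (by fun_prop) (by fun_prop)
  suffices d ∈ closure A from hclosed.closure_subset this
  refine Metric.mem_closure_iff.2 fun ε hε => ?_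
  have hlt : d < d + min ε 1 := lt_add_of_pos_right d (lt_min hε one_pos)
  obtain ⟨T, c, W, hT, hW, rfl, rfl, hW0, hWT⟩ := hsym.exists_isArcLength hcv hlt
  have hdW : d ≤ W T := by
    have := hW.dist_le hsym hT
    rwa [hW0, sub_zero] at this
  refine ⟨W T, hsym.dist_smul_mul_le_of_isArcLength hcv hW hT hW0 (hd0.trans_le hdW) ?_ hs hs2, ?_⟩
  · linarith [min_le_right ε 1]
  · rw [dist_comm, Real.dist_eq, abs_of_nonneg (sub_nonneg.2 hdW)]
    linarith [min_le_left ε 1]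

theorem IsSphericallySymmetric.stewart_le (hsym : IsSphericallySymmetric p G Φ)
    (hcv : ConvexOn ℝ (Ioi 0) G) {a b c : M} (hab : a ≠ b) (hbc : b ≠ c)
    (habc : dist a b + dist b c = dist a c) :
    (dist a b + dist b c) * dist b p ^ 2 + dist a b * dist b c * (dist a b + dist b c) ≤
      dist b c * dist a p ^ 2 + dist a b * dist c p ^ 2 := by
  obtain ⟨x, rfl⟩ := Φ.surjective a
  obtain ⟨y, rfl⟩ := Φ.surjective b
  obtain ⟨z, rfl⟩ := Φ.surjective c
  have hd1 : 0 < dist (Φ x) (Φ y) := dist_pos.2 hab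
  have hd2 : 0 < dist (Φ z) (Φ y) := dist_pos.2 hbc.symm
  rw [dist_comm (Φ y) (Φ z)] at habc ⊢
  simp only [hsym.2.2.1]
  set d₁ := dist (Φ x) (Φ y)
  set d₂ := dist (Φ z) (Φ y)
  set C := d₂ * (‖x‖ + d₁ + 1) ^ 2 + d₁ * (‖z‖ + d₂ + 1) ^ 2 with hC
  set B := (d₁ + d₂) * ‖y‖ ^ 2 + d₁ * d₂ * (d₁ + d₂) -
    (d₂ * ‖x‖ ^ 2 + d₁ * ‖z‖ ^ 2) with hB
  have hC0 : 0 < C := by positivity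
  have key : ∀ s : ℝ, 0 < s → s ≤ 1 / 2 → B ≤ 2 * s * C := by
    intro s hs hs2
    have h1 := hsym.dist_smul_mul_le hcv (fun h => hab (congrArg Φ h)) hs hs2 (x := x) (y := y)
    have h2 := hsym.dist_smul_mul_le hcv (fun h => hbc (congrArg Φ h.symm)) hs hs2
      (x := z) (y := y)
    have h3 : d₁ + d₂ ≤ dist (Φ x) (Φ ((1 - s) • y)) + dist (Φ z) (Φ ((1 - s) • y)) := by
      rw [habc]
      exact dist_triangle_right _ _ _
    have h4 : 0 ≤ s * (2 * s * C - B) := by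
      rw [hC, hB]
      nlinarith [mul_le_mul_of_nonneg_left h1 hd2.le, mul_le_mul_of_nonneg_left h2 hd1.le,
        mul_le_mul_of_nonneg_left h3 (mul_pos hd1 hd2).le]
    linarith [nonneg_of_mul_nonneg_right h4 hs]
  suffices B ≤ 0 by linarith
  by_contra! hBpos
  have h := key (min (1 / 2) (B / (4 * C))) (by positivity) (min_le_left _ _)
  have h' : 2 * min (1 / 2) (B / (4 * C)) * C ≤ 2 * (B / (4 * C)) * C := by
    gcongr
    exact min_le_right _ _
  have h'' : 2 * (B / (4 * C)) * C = B / 2 := by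
    field_simp
    ring
  linarith

end Convexity

/-! ### Geodesics issuing from `q` and the boundary of `Ω₁` -/

section Boundary

variable {n : ℕ} {G : ℝ → ℝ} {p : M} {Φ : Euc n ≃ M}

theorem IsSphericallySymmetric.norm_symm (hsym : IsSphericallySymmetric p G Φ) (x : M) :
    ‖Φ.symm x‖ = dist x p := by
  rw [← hsym.2.2.1, Φ.apply_symm_apply]

theorem IsSphericallySymmetric.symm_ne_zero (hsym : IsSphericallySymmetric p G Φ) {x : M}
    (hx : x ≠ p) : Φ.symm x ≠ 0 := by
  rw [← norm_pos_iff, hsym.norm_symm]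
  exact dist_pos.2 hx

theorem IsSphericallySymmetric.sq_mul_dist_add_le (hsym : IsSphericallySymmetric p G Φ)
    (hcv : ConvexOn ℝ (Ioi 0) G) {a b c : M} (hab : a ≠ b) (hbc : b ≠ c)
    (habc : dist a b + dist b c = dist a c) :
    (dist a c * dist b p) ^ 2 +
        dist a b * dist b c * (dist a c ^ 2 - (dist a p - dist c p) ^ 2) ≤
      (dist b c * dist a p + dist a b * dist c p) ^ 2 := by
  have hst := mul_le_mul_of_nonneg_left (hsym.stewart_le hcv hab hbc habc)
    (add_nonneg (dist_nonneg (x := a) (y := b)) (dist_nonneg (x := b) (y := c)))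
  rw [← habc]
  linear_combination hst

/-- The distance to `p` is convex along geodesic segments. -/
theorem IsSphericallySymmetric.mul_dist_le (hsym : IsSphericallySymmetric p G Φ)
    (hcv : ConvexOn ℝ (Ioi 0) G) {a b c : M} (hab : a ≠ b) (hbc : b ≠ c)
    (habc : dist a b + dist b c = dist a c) :
    dist a c * dist b p ≤ dist b c * dist a p + dist a b * dist c p := by
  have h := abs_le.1 (abs_dist_sub_le a c p)
  have hsq := mul_nonneg
    (mul_nonneg (dist_nonneg (x := a) (y := b)) (dist_nonneg (x := b) (y := c)))
    (sub_nonneg.2 (sq_le_sq' h.1 h.2))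
  exact le_of_pow_le_pow_left₀ two_ne_zero (by positivity)
    (by linarith [hsym.sq_mul_dist_add_le hcv hab hbc habc])

/-- The distance to `p` is strictly convex along a geodesic segment which is not radial. -/
theorem IsSphericallySymmetric.mul_dist_lt (hsym : IsSphericallySymmetric p G Φ)
    (hcv : ConvexOn ℝ (Ioi 0) G) {a b c : M} (hab : a ≠ b) (hbc : b ≠ c)
    (habc : dist a b + dist b c = dist a c) (h : |dist a p - dist c p| < dist a c) :
    dist a c * dist b p < dist b c * dist a p + dist a b * dist c p := by
  have hsq := mul_pos (mul_pos (dist_pos.2 hab) (dist_pos.2 hbc))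
    (sub_pos.2 (sq_lt_sq' (abs_lt.1 h).1 (abs_lt.1 h).2))
  exact lt_of_pow_lt_pow_left₀ 2 (by positivity)
    (by linarith [hsym.sq_mul_dist_add_le hcv hab hbc habc])

/-- Linear isometries of the chart act by distance nonincreasing maps. -/
theorem IsSphericallySymmetric.dist_isometry_le (hsym : IsSphericallySymmetric p G Φ)
    (hcv : ConvexOn ℝ (Ioi 0) G) (e : Euc n ≃ₗᵢ[ℝ] Euc n) (x y : Euc n) :
    dist (Φ (e x)) (Φ (e y)) ≤ dist (Φ x) (Φ y) := by
  refine le_of_forall_gt_imp_ge_of_dense fun ℓ hℓ => ?_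
  obtain ⟨T, c, W, hT, hW, rfl, rfl, hW0, hWT⟩ := hsym.exists_isArcLength hcv hℓ
  obtain ⟨K, hK⟩ := hW.lipschitz_curve
  obtain ⟨C, hC⟩ := hW.lipschitz_length
  have := hsym.dist_le hT (c := fun t => e (c t)) (E := W)
    (e.isometry.lipschitz.comp hK).lipschitzOnWith
    hC.lipschitzOnWith.absolutelyContinuousOnInterval (by
      filter_upwards [hW.ae_hasDerivAt] with t ht _
      have he : HasDerivAt (fun t => e (c t)) (e (deriv c t)) t :=
        e.toContinuousLinearEquiv.toContinuousLinearMap.hasFDerivAt.comp_hasDerivAt t ht.1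
      rw [he.deriv, ht.2.deriv, warpNorm_isometry])
  linarith

theorem IsSphericallySymmetric.dist_smul_smul_le (hsym : IsSphericallySymmetric p G Φ)
    {u : Euc n} (hu : ‖u‖ = 1) {a b : ℝ} (ha : 0 < a) (hb : 0 < b) :
    dist (Φ (a • u)) (Φ (b • u)) ≤ |a - b| := by
  wlog hab : a ≤ b generalizing a b
  · rw [dist_comm, abs_sub_comm]
    exact this hb ha (le_of_not_ge hab)
  have hc : LipschitzWith 1 (fun t : ℝ => (a + t) • u) :=
    LipschitzWith.of_dist_le_mul fun s t => by
      rw [dist_eq_norm, ← sub_smul, norm_smul, hu]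
      simp [Real.dist_eq]
  have := hsym.dist_le (sub_nonneg.2 hab) (c := fun t => (a + t) • u) (E := fun t => t)
    hc.lipschitzOnWith LipschitzWith.id.lipschitzOnWith.absolutelyContinuousOnInterval (by
      refine Eventually.of_forall fun t ht => ?_
      have hd : HasDerivAt (fun t : ℝ => (a + t) • u) ((1 : ℝ) • u) t :=
        ((hasDerivAt_id t).const_add a).smul_const u
      have := warpNorm_smul_smul_le (G := G) (add_pos_of_pos_of_nonneg ha ht.1) 1 u
      rw [hd.deriv]
      simpa [hu] using this)
  simp only [add_zero, add_sub_cancel, sub_zero] at this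
  exact this.trans (neg_sub a b ▸ neg_le_abs _)

theorem angle_eq_of_norm_sub_le {E : Type*} [NormedAddCommGroup E] [InnerProductSpace ℝ E]
    {x y : E} (hx : x ≠ 0) (hy : y ≠ 0) (h : ‖x - y‖ ≤ |‖x‖ - ‖y‖|) (z : E) :
    angle x z = angle y z := by
  obtain ⟨r, hr, rfl⟩ := (sameRay_iff_norm_sub.2
    (h.antisymm (abs_norm_sub_norm_le x y))).exists_pos_left hx hy
  rw [angle_smul_left_of_pos _ _ hr]

/-- Along a geodesic issuing from a point `q` different from `p`, the angle with the direction
of `q` is nondecreasing. -/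
theorem IsSphericallySymmetric.angle_le_angle (hsym : IsSphericallySymmetric p G Φ)
    (hcv : ConvexOn ℝ (Ioi 0) G) {γ : ℝ → M} {s t : ℝ} (hs : 0 ≤ s) (hst : s ≤ t)
    (hgeo : ∀ u ∈ Icc (0 : ℝ) t, ∀ v ∈ Icc (0 : ℝ) t, dist (γ u) (γ v) = |u - v|)
    (h0 : γ 0 ≠ p) (h1 : γ s ≠ p) (h2 : γ t ≠ p) :
    angle (Φ.symm (γ s)) (Φ.symm (γ 0)) ≤ angle (Φ.symm (γ t)) (Φ.symm (γ 0)) := by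
  have ht : 0 ≤ t := hs.trans hst
  set c : ℝ → Euc n := fun u => Φ.symm (γ u) with hcdef
  have hΦc : ∀ u, Φ (c u) = γ u := fun u => Φ.apply_symm_apply _
  have hdist : ∀ u ∈ Icc (0 : ℝ) t, ∀ v ∈ Icc (0 : ℝ) t, dist (Φ (c u)) (Φ (c v)) = |u - v| := by
    simpa only [hΦc] using hgeo
  have hlip : ∀ u ∈ Icc (0 : ℝ) t, ∀ v ∈ Icc (0 : ℝ) t, ‖c u - c v‖ ≤ |u - v| :=
    fun u hu v hv => (hsym.norm_sub_le_dist hcv _ _).trans_eq (hdist u hu v hv)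
  have hc0 : c 0 ≠ 0 := hsym.symm_ne_zero h0
  have hcs : c s ≠ 0 := hsym.symm_ne_zero h1
  have hct : c t ≠ 0 := hsym.symm_ne_zero h2
  have m0 : (0 : ℝ) ∈ Icc 0 t := ⟨le_rfl, ht⟩
  have ms : s ∈ Icc 0 t := ⟨hs, hst⟩
  have mt : t ∈ Icc 0 t := ⟨ht, le_rfl⟩
  change angle (c s) (c 0) ≤ angle (c t) (c 0)
  by_contra! hlt
  by_cases hzero : ∃ u ∈ Icc (0 : ℝ) t, c u = 0
  · obtain ⟨u, hu, hcu⟩ := hzero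
    have hnorm : ∀ v ∈ Icc (0 : ℝ) t, ‖c v‖ = |v - u| := fun v hv => by
      rw [← hdist v hv u hu, hcu, hsym.2.1, hsym.2.2.1]
    rcases le_total u s with hus | hsu
    · refine hlt.ne (angle_eq_of_norm_sub_le hct hcs ?_ _)
      rw [hnorm t mt, hnorm s ms, abs_of_nonneg (sub_nonneg.2 hus),
        abs_of_nonneg (sub_nonneg.2 (hus.trans hst)), sub_sub_sub_cancel_right]
      exact hlip t mt s ms
    · have := angle_eq_of_norm_sub_le hcs hc0 (z := c 0) (by
        rw [hnorm 0 m0, hnorm s ms, abs_of_nonpos (sub_nonpos.2 hsu),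
          abs_of_nonpos (sub_nonpos.2 hu.1)]
        convert hlip s ms 0 m0 using 1
        rw [abs_sub_comm]
        congr 1
        ring)
      rw [this, angle_self hc0] at hlt
      exact hlt.not_ge (angle_nonneg _ _)
  · push Not at hzero
    have hcont : ContinuousOn c (Icc 0 t) :=
      (LipschitzOnWith.of_dist_le_mul (K := 1) fun u hu v hv => by
        simpa [dist_eq_norm] using hlip u hu v hv).continuousOn
    have hsub : Icc 0 s ⊆ Icc 0 t := Icc_subset_Icc_right hst
    have hang : ContinuousOn (fun u => angle (c u) (c 0)) (Icc 0 s) := fun u hu =>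
      (continuousAt_angle (x := (c u, c 0)) (hzero u (hsub hu)) hc0).comp_continuousWithinAt
        (f := fun u => (c u, c 0)) (((hcont.mono hsub) u hu).prodMk continuousWithinAt_const)
    obtain ⟨u, hu, hangu⟩ := intermediate_value_Icc hs hang
      (show angle (c t) (c 0) ∈ _ from ⟨by simpa [angle_self hc0] using angle_nonneg _ _, hlt.le⟩)
    have mu := hsub hu
    have hcu := hzero u mu
    have hu0 : 0 < ‖c u‖ := norm_pos_iff.2 hcu
    have ht0 : 0 < ‖c t‖ := norm_pos_iff.2 hct
    have hq0 : 0 < ‖c 0‖ := norm_pos_iff.2 hc0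
    set v : Euc n := ‖c u‖⁻¹ • c u with hv
    set w : Euc n := ‖c t‖⁻¹ • c t with hw
    have hv1 : ‖v‖ = 1 := norm_smul_inv_norm hcu
    have hw1 : ‖w‖ = 1 := norm_smul_inv_norm hct
    have huv : c u = ‖c u‖ • v := by rw [hv, smul_inv_smul₀ hu0.ne']
    have htw : c t = ‖c t‖ • w := by rw [hw, smul_inv_smul₀ ht0.ne']
    have hperp : ⟪v - w, c 0⟫ = 0 := by
      have e1 := cos_angle_mul_norm_mul_norm (c u) (c 0)
      have e2 := cos_angle_mul_norm_mul_norm (c t) (c 0)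
      simp only at hangu
      rw [inner_sub_left, hv, hw, real_inner_smul_left, real_inner_smul_left, ← e1, ← e2, hangu]
      field_simp
      ring
    set e := (ℝ ∙ (v - w))ᗮ.reflection with he
    have hev : e v = w := Submodule.reflection_sub (hv1.trans hw1.symm)
    have heq : e (c 0) = c 0 := by
      rw [he, Submodule.reflection_eq_self_iff, Submodule.mem_orthogonal_singleton_iff_inner_right]
      exact hperp
    have heu : e (c u) = ‖c u‖ • w := by
      conv_lhs => rw [huv]
      rw [map_smul, hev]
    have d1 : dist (Φ (c 0)) (Φ (‖c u‖ • w)) ≤ u := by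
      have := hsym.dist_isometry_le hcv e (c 0) (c u)
      rwa [heq, heu, hdist 0 m0 u mu, zero_sub, abs_neg, abs_of_nonneg hu.1] at this
    have d2 : dist (Φ (‖c u‖ • w)) (Φ (c t)) ≤ |‖c u‖ - ‖c t‖| := by
      conv_lhs => rw [htw]
      exact hsym.dist_smul_smul_le hw1 hu0 ht0
    have d3 : t ≤ u + |‖c u‖ - ‖c t‖| := by
      have := hdist 0 m0 t mt
      rw [zero_sub, abs_neg, abs_of_nonneg ht] at this
      linarith [dist_triangle (Φ (c 0)) (Φ (‖c u‖ • w)) (Φ (c t))]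
    have d4 : |‖c u‖ - ‖c s‖| ≤ s - u :=
      (abs_norm_sub_norm_le _ _).trans ((hlip u mu s ms).trans_eq
        (by rw [abs_sub_comm, abs_of_nonneg (sub_nonneg.2 hu.2)]))
    have d5 : ‖c t - c s‖ ≤ t - s :=
      (hlip t mt s ms).trans_eq (abs_of_nonneg (sub_nonneg.2 hst))
    refine hlt.ne (angle_eq_of_norm_sub_le hct hcs ?_ _)
    have := abs_sub_le ‖c u‖ ‖c s‖ ‖c t‖
    rw [abs_sub_comm ‖c t‖]
    linarith

theorem IsSphericallySymmetric.omegaSeq_one (hsym : IsSphericallySymmetric p G Φ)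
    (hcv : ConvexOn ℝ (Ioi 0) G) (q : M) {lam : ℝ} (hlam : 0 ≤ lam) :
    OmegaSeq p q lam 1 = {x | lam * dist x p < dist x q} := by
  ext x
  simp only [OmegaSeq, empty_union, mem_empty_iff_false, not_false_eq_true, true_and, mem_ofPred_eq,
    hsym.dCompl_empty hcv]
  exact ENNReal.ofReal_lt_ofReal_iff_of_nonneg (mul_nonneg hlam dist_nonneg)

theorem IsSphericallySymmetric.mul_dist_eq_of_mem_frontier
    (hsym : IsSphericallySymmetric p G Φ) (hcv : ConvexOn ℝ (Ioi 0) G) {q x : M} {lam : ℝ}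
    (hlam : 0 ≤ lam) (hx : x ∈ frontier (OmegaSeq p q lam 1)) : lam * dist x p = dist x q := by
  rw [hsym.omegaSeq_one hcv q hlam] at hx
  exact frontier_lt_subset_eq (by fun_prop) (by fun_prop) hx

/-- Between two points of `∂Ω₁`, a geodesic issuing from `q` runs inside `Ω₁`. -/
theorem IsSphericallySymmetric.mem_omegaSeq_one_of_mem_frontier
    (hsym : IsSphericallySymmetric p G Φ) (hcv : ConvexOn ℝ (Ioi 0) G) {lam : ℝ} (hlam : 1 < lam)
    {S : ℝ} {γ : ℝ → M}
    (hgeo : ∀ s ∈ Icc (0 : ℝ) S, ∀ t ∈ Icc (0 : ℝ) S, dist (γ s) (γ t) = |s - t|)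
    {a b c : ℝ} (ha : 0 ≤ a) (hab : a < b) (hbc : b < c) (hc : c ≤ S)
    (hfa : γ a ∈ frontier (OmegaSeq p (γ 0) lam 1))
    (hfc : γ c ∈ frontier (OmegaSeq p (γ 0) lam 1)) :
    γ b ∈ OmegaSeq p (γ 0) lam 1 := by
  have hlam0 : 0 < lam := one_pos.trans hlam
  have m0 : (0 : ℝ) ∈ Icc 0 S := ⟨le_rfl, by linarith⟩
  have ma : a ∈ Icc 0 S := ⟨ha, by linarith⟩
  have mb : b ∈ Icc 0 S := ⟨by linarith, by linarith⟩
  have mc : c ∈ Icc 0 S := ⟨by linarith, hc⟩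
  have eab : dist (γ a) (γ b) = b - a := by
    rw [hgeo a ma b mb, abs_sub_comm, abs_of_pos (sub_pos.2 hab)]
  have ebc : dist (γ b) (γ c) = c - b := by
    rw [hgeo b mb c mc, abs_sub_comm, abs_of_pos (sub_pos.2 hbc)]
  have eac : dist (γ a) (γ c) = c - a := by
    rw [hgeo a ma c mc, abs_sub_comm, abs_of_pos (by linarith)]
  have hA := hsym.mul_dist_eq_of_mem_frontier hcv hlam0.le hfa
  have hC := hsym.mul_dist_eq_of_mem_frontier hcv hlam0.le hfc
  rw [hgeo a ma 0 m0, sub_zero, abs_of_nonneg ha] at hA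
  rw [hgeo c mc 0 m0, sub_zero, abs_of_nonneg mc.1] at hC
  rw [hsym.omegaSeq_one hcv _ hlam0.le, mem_ofPred_eq, hgeo b mb 0 m0, sub_zero, abs_of_nonneg mb.1]
  have hne : ∀ {u v : ℝ}, u < v → dist (γ u) (γ v) = v - u → γ u ≠ γ v := fun huv h heq => by
    rw [heq, dist_self] at h
    linarith
  have hdiff : lam * (dist (γ c) p - dist (γ a) p) = c - a := by rw [mul_sub, hA, hC]
  have hlt := hsym.mul_dist_lt hcv (hne hab eab) (hne hbc ebc) (by rw [eab, ebc, eac]; ring) (by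
    rw [eac, abs_sub_comm, abs_of_pos (pos_of_mul_pos_right (by linarith) hlam0.le)]
    nlinarith)
  rw [eab, ebc, eac] at hlt
  have := mul_lt_mul_of_pos_left hlt hlam0
  nlinarith

theorem IsSphericallySymmetric.ne_of_mem_frontier (hsym : IsSphericallySymmetric p G Φ)
    (hcv : ConvexOn ℝ (Ioi 0) G) {q x : M} (hq : q ≠ p) {lam : ℝ} (hlam : 0 ≤ lam)
    (hx : x ∈ frontier (OmegaSeq p q lam 1)) : x ≠ p := by
  rintro rfl
  have := hsym.mul_dist_eq_of_mem_frontier hcv hlam hx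
  rw [dist_self, mul_zero] at this
  exact hq (dist_eq_zero.1 this.symm).symm

theorem IsSphericallySymmetric.notMem_omegaSeq_one_of_mem_frontier
    (hsym : IsSphericallySymmetric p G Φ) (hcv : ConvexOn ℝ (Ioi 0) G) {q x : M} {lam : ℝ}
    (hlam : 0 ≤ lam) (hx : x ∈ frontier (OmegaSeq p q lam 1)) : x ∉ OmegaSeq p q lam 1 := by
  rw [hsym.omegaSeq_one hcv q hlam, mem_ofPred_eq, hsym.mul_dist_eq_of_mem_frontier hcv hlam hx]
  exact lt_irrefl _

theorem IsSphericallySymmetric.angle_polarTheta (hsym : IsSphericallySymmetric p G Φ) {x y : M}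
    (hx : x ≠ p) (hy : y ≠ p) :
    angle (polarTheta Φ x) (polarTheta Φ y) = angle (Φ.symm x) (Φ.symm y) := by
  rw [polarTheta, polarTheta,
    angle_smul_left_of_pos _ _ (inv_pos.2 (norm_pos_iff.2 (hsym.symm_ne_zero hx))),
    angle_smul_right_of_pos _ _ (inv_pos.2 (norm_pos_iff.2 (hsym.symm_ne_zero hy)))]

/-- If a minimizing segment from `q` to a point `x` of `∂Ω₁` extends beyond `x` to another point
`y` of `∂Ω₁`, then `x` is visible from `q`. -/
theorem IsSphericallySymmetric.visibleThrough_of_mem_frontier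
    (hsym : IsSphericallySymmetric p G Φ) (hcv : ConvexOn ℝ (Ioi 0) G) {lam : ℝ} (hlam : 0 < lam)
    {q x y : M} (hxy : x ≠ y) (hqxy : dist q x + dist x y = dist q y)
    (hx : x ∈ frontier (OmegaSeq p q lam 1)) (hy : y ∈ frontier (OmegaSeq p q lam 1)) :
    VisibleThrough (OmegaSeq p q lam 1) q x := by
  rintro σ ⟨hσ0, hσx, hσ⟩ t ht hmem
  have hzx : σ t ≠ x := fun h =>
    hsym.notMem_omegaSeq_one_of_mem_frontier hcv hlam.le hx (h ▸ hmem)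
  rw [hsym.omegaSeq_one hcv q hlam.le, mem_ofPred_eq] at hmem
  have hX := hsym.mul_dist_eq_of_mem_frontier hcv hlam.le hx
  have hY := hsym.mul_dist_eq_of_mem_frontier hcv hlam.le hy
  have e0 : dist q (σ t) = t := by
    have := hσ 0 ⟨le_rfl, dist_nonneg⟩ t ht
    rwa [hσ0, zero_sub, abs_neg, abs_of_nonneg ht.1] at this
  have e1 : dist (σ t) x = dist q x - t := by
    have := hσ t ht (dist q x) ⟨dist_nonneg, le_rfl⟩
    rwa [hσx, abs_sub_comm, abs_of_nonneg (sub_nonneg.2 ht.2)] at this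
  have e2 : dist (σ t) x + dist x y = dist (σ t) y := by
    refine le_antisymm ?_ (dist_triangle _ _ _)
    linarith [dist_triangle q (σ t) y]
  have hle := mul_le_mul_of_nonneg_left (hsym.mul_dist_le hcv hzx hxy e2) hlam.le
  rw [dist_comm _ q, e0] at hmem
  rw [dist_comm _ q] at hX hY
  have hlt := mul_lt_mul_of_pos_left hmem (dist_pos.2 hxy)
  rw [← e2, e1] at hle
  rw [← hqxy] at hY
  have k1 : (dist q x - t + dist x y) * (lam * dist x p) =
      (dist q x - t + dist x y) * dist q x := by rw [hX]
  have k2 : (dist q x - t) * (lam * dist y p) =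
      (dist q x - t) * (dist q x + dist x y) := by rw [hY]
  linarith

end Boundary

/-- Lemma 3.3.  Suppose `M` is spherically symmetric about
`p` and nonpositively curved.  A geodesic emanating from `q` (on a
nonpositively curved, simply connected manifold geodesics are globally
minimizing, hence metric geodesics) meets `∂Ω_1` at most twice; if it meets
`∂Ω_1` at `x₁ = (r₁,θ₁)` and `x₂ = (r₂,θ₂)` with `∠(θ₁,u₀) < ∠(θ₂,u₀)`,
then `x₁` is visible₁ while `x₂` is not.  Here `u₀ = θ(q)` is the angular
coordinate of `q`. -/
theorem geodesic_meets_omega1_boundary_at_most_twice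
    {M : Type*} [MetricSpace M] [ProperSpace M] {n : ℕ}
    (p : M) (G : ℝ → ℝ) (Φ : Euc n ≃ M)
    (hsym : IsSphericallySymmetric p G Φ) (hnpc : NonposCurvWarping G)
    (q : M) (hq : q ≠ p) (lam : ℝ) (hlam : 1 < lam)
    (S : ℝ) (hS : 0 ≤ S) (γ : ℝ → M) (hγ0 : γ 0 = q)
    (hgeo : ∀ s ∈ Set.Icc (0 : ℝ) S, ∀ t ∈ Set.Icc (0 : ℝ) S,
      dist (γ s) (γ t) = |s - t|) :
    ({t ∈ Set.Icc (0 : ℝ) S | γ t ∈ frontier (OmegaSeq p q lam 1)}.encard ≤ 2) ∧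
    (∀ t₁ ∈ Set.Icc (0 : ℝ) S, ∀ t₂ ∈ Set.Icc (0 : ℝ) S,
      γ t₁ ∈ frontier (OmegaSeq p q lam 1) →
      γ t₂ ∈ frontier (OmegaSeq p q lam 1) →
      angle (polarTheta Φ (γ t₁)) (polarTheta Φ q) <
        angle (polarTheta Φ (γ t₂)) (polarTheta Φ q) →
      VisibleThrough (OmegaSeq p q lam 1) q (γ t₁) ∧
        ¬ VisibleThrough (OmegaSeq p q lam 1) q (γ t₂)) := by
  subst hγ0
  have hlam0 : 0 ≤ lam := (one_pos.trans hlam).le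
  have hcv := hnpc.1
  refine ⟨?_, fun t₁ ht₁ t₂ ht₂ h₁ h₂ hang => ?_⟩
  · have key : ∀ {a b c : ℝ}, a ∈ Icc 0 S → c ∈ Icc 0 S → a < b → b < c →
        γ a ∈ frontier (OmegaSeq p (γ 0) lam 1) → γ b ∈ frontier (OmegaSeq p (γ 0) lam 1) →
        γ c ∈ frontier (OmegaSeq p (γ 0) lam 1) → False := fun ha hc hab hbc ka kb kc =>
      hsym.notMem_omegaSeq_one_of_mem_frontier hcv hlam0 kb
        (hsym.mem_omegaSeq_one_of_mem_frontier hcv hlam hgeo ha.1 hab hbc hc.2 ka kc)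
    by_contra! hcard
    obtain ⟨s, hs, hs3⟩ := exists_subset_encard_eq (k := 3)
      (by simpa [two_add_one_eq_three] using Order.add_one_le_of_lt hcard)
    obtain ⟨a, b, c, hab, hac, hbc, rfl⟩ := encard_eq_three.1 hs3
    obtain ⟨ha, ka⟩ := hs (show a ∈ _ by simp)
    obtain ⟨hb, kb⟩ := hs (show b ∈ _ by simp)
    obtain ⟨hc, kc⟩ := hs (show c ∈ _ by simp)
    rcases lt_or_gt_of_ne hab with h1 | h1 <;> rcases lt_or_gt_of_ne hac with h2 | h2 <;>
      rcases lt_or_gt_of_ne hbc with h3 | h3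
    · exact key ha hc h1 h3 ka kb kc
    · exact key ha hb h2 h3 ka kc kb
    · linarith
    · exact key hc hb h2 h1 kc ka kb
    · exact key hb hc h1 h2 kb ka kc
    · linarith
    · exact key hb ha h3 h2 kb kc ka
    · exact key hc ha h3 h1 kc kb ka
  · have hp₁ := hsym.ne_of_mem_frontier hcv hq hlam0 h₁
    have hp₂ := hsym.ne_of_mem_frontier hcv hq hlam0 h₂
    have m0 : (0 : ℝ) ∈ Icc 0 S := ⟨le_rfl, hS⟩
    rw [hsym.angle_polarTheta hp₁ hq, hsym.angle_polarTheta hp₂ hq] at hang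
    have hlt : t₁ < t₂ := by
      by_contra! hle
      have hsub : Icc 0 t₁ ⊆ Icc 0 S := Icc_subset_Icc_right ht₁.2
      exact hang.not_ge (hsym.angle_le_angle hcv ht₂.1 hle
        (fun u hu v hv => hgeo u (hsub hu) v (hsub hv)) hq hp₂ hp₁)
    have e₁ : dist (γ 0) (γ t₁) = t₁ := by
      rw [hgeo 0 m0 t₁ ht₁, zero_sub, abs_neg, abs_of_nonneg ht₁.1]
    have e₂ : dist (γ 0) (γ t₂) = t₂ := by
      rw [hgeo 0 m0 t₂ ht₂, zero_sub, abs_neg, abs_of_nonneg ht₂.1]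
    have e₁₂ : dist (γ t₁) (γ t₂) = t₂ - t₁ := by
      rw [hgeo t₁ ht₁ t₂ ht₂, abs_sub_comm, abs_of_pos (sub_pos.2 hlt)]
    refine ⟨hsym.visibleThrough_of_mem_frontier hcv (one_pos.trans hlam)
      (dist_pos.1 (e₁₂ ▸ sub_pos.2 hlt)) (by rw [e₁, e₂, e₁₂]; ring) h₁ h₂, fun hvis => ?_⟩
    have hsub : Icc 0 t₂ ⊆ Icc 0 S := Icc_subset_Icc_right ht₂.2
    refine hvis γ ⟨rfl, by rw [e₂], ?_⟩ ((t₁ + t₂) / 2) ?_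
      (hsym.mem_omegaSeq_one_of_mem_frontier hcv hlam hgeo ht₁.1 (b := (t₁ + t₂) / 2)
        (by linarith) (by linarith) ht₂.2 h₁ h₂)
    · rw [e₂]
      exact fun u hu v hv => hgeo u (hsub hu) v (hsub hv)
    · rw [e₂]
      exact ⟨by linarith [ht₁.1], by linarith⟩

end GrowthComp
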